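/- arXiv:2306.00350 — 3 statements merged into one kernel-verified Lean document; each statement's English description precedes it below -/
import Mathlib

section
/- Deviation bound for modification-R Nash distributions: Fix ε ≥ 0. Every Nash distribution π̄_R with modification-R with parameter ε is an ε′-Nash equilibrium with ε′ = ε · log|A| · Σ_{k=0}^{T−1} γ^k; that is, for every player i and every π^i ∈ Π^i, u^i(π^i, π̄_R^{−i}) − u^i(π̄_R) ≤ ε · log|A| · Σ_{k=0}^{T−1} γ^k. -/
open scoped Classical BigOperators

noncomputable section

/-- An `n`-player finite-horizon imperfect-information game with simultaneous moves
(a finite-horizon POSG).  `Obs` is the joint-observation kernel, `O0` the initial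
joint-observation kernel, `Tr` the transition kernel, `R` the reward functions. -/
structure POSG where
  n : ℕ
  n_pos : 0 < n
  S : Type
  [S_fin : Fintype S]
  [S_ne : Nonempty S]
  Z : Fin n → Type
  [Z_fin : ∀ i, Fintype (Z i)]
  [Z_ne : ∀ i, Nonempty (Z i)]
  A : Type
  [A_fin : Fintype A]
  [A_ne : Nonempty A]
  T : ℕ
  T_pos : 1 ≤ T
  γ : ℝ
  γ_pos : 0 < γ
  γ_le_one : γ ≤ 1
  ρ : S → ℝ
  ρ_nonneg : ∀ s, 0 ≤ ρ s
  ρ_sum : ∑ s, ρ s = 1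
  O0 : S → (∀ i, Z i) → ℝ
  O0_nonneg : ∀ s z, 0 ≤ O0 s z
  O0_sum : ∀ s, ∑ z, O0 s z = 1
  Tr : S → (Fin n → A) → S → ℝ
  Tr_nonneg : ∀ s a s', 0 ≤ Tr s a s'
  Tr_sum : ∀ s a, ∑ s', Tr s a s' = 1
  Obs : S → (Fin n → A) → S → (∀ i, Z i) → ℝ
  Obs_nonneg : ∀ s a s' z, 0 ≤ Obs s a s' z
  Obs_sum : ∀ s a s', ∑ z, Obs s a s' z = 1
  R : Fin n → S → (Fin n → A) → S → ℝ

attribute [instance] POSG.S_fin POSG.S_ne POSG.Z_fin POSG.Z_ne POSG.A_fin POSG.A_ne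

/-- Softmax choice map with regularization parameter `ε`. -/
def softmax {α : Type*} [Fintype α] (ε : ℝ) (y : α → ℝ) (a : α) : ℝ :=
  Real.exp (y a / ε) / ∑ b, Real.exp (y b / ε)

/-- Negative Gibbs entropy `H(p) = ∑ₐ p a * log (p a)` (with `0 * log 0 = 0`). -/
def negEnt {α : Type*} [Fintype α] (p : α → ℝ) : ℝ := ∑ a, p a * Real.log (p a)

namespace POSG

variable (G : POSG)

/-- Joint actions. -/
abbrev JointAct := Fin G.n → G.A

/-- Tuples of observations, one for each player. -/
abbrev ObsTuple := ∀ i, G.Z i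

/-- Global histories at step `t`:
`h_t = (s_0, z̄_0, ā_0, …, ā_{t-1}, s_t, z̄_t)`. -/
abbrev Hist (t : ℕ) := (Fin (t + 1) → G.S) × (Fin (t + 1) → G.ObsTuple) × (Fin t → G.JointAct)

/-- Local trajectories (information sets) of player `i` at step `t`:
`x_t^i = (z_0^i, a_0^i, …, a_{t-1}^i, z_t^i)`. -/
abbrev LocTraj (i : Fin G.n) (t : ℕ) := (Fin (t + 1) → G.Z i) × (Fin t → G.A)

/-- Reduction of a global history to player `i`'s local trajectory;
`h ∈ x` is expressed as `G.red i h = x`. -/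
def red (i : Fin G.n) {t : ℕ} (h : G.Hist t) : G.LocTraj i t :=
  (fun k => h.2.1 k i, fun k => h.2.2 k i)

/-- A policy of player `i` assigns to every local trajectory a vector of action weights. -/
abbrev Policy (i : Fin G.n) := ∀ t : Fin G.T, G.LocTraj i t.1 → G.A → ℝ

/-- Joint policies. -/
abbrev JointPolicy := ∀ i : Fin G.n, G.Policy i

/-- The score space: one real number for each information-set–action pair. -/
abbrev Score := ∀ i : Fin G.n, ∀ t : Fin G.T, G.LocTraj i t.1 → G.A → ℝ

/-- `p` is a genuine (probability-simplex valued) policy. -/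
def IsPolicy {i : Fin G.n} (p : G.Policy i) : Prop :=
  (∀ t x a, 0 ≤ p t x a) ∧ (∀ t x, ∑ a, p t x a = 1)

def IsJointPolicy (π : G.JointPolicy) : Prop := ∀ i, G.IsPolicy (π i)

/-- Fully mixed joint policy: all actions have positive probability everywhere. -/
def FullyMixed (π : G.JointPolicy) : Prop := ∀ i t x a, 0 < π i t x a

/-- Current (last) state of a history. -/
def lastState {t : ℕ} (h : G.Hist t) : G.S := h.1 (Fin.last t)

/-- Probability of a joint action at a history under a joint policy. -/
def polProb (π : G.JointPolicy) {t : ℕ} (h : G.Hist t) (a : G.JointAct) : ℝ :=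
  if ht : t < G.T then ∏ i, π i ⟨t, ht⟩ (G.red i h) (a i) else 0

/-- Extension of a history by one step. -/
def extend {t : ℕ} (h : G.Hist t) (a : G.JointAct) (s' : G.S) (z' : G.ObsTuple) :
    G.Hist (t + 1) :=
  (Fin.snoc h.1 s', Fin.snoc h.2.1 z', Fin.snoc h.2.2 a)

/-- The one-step-shorter prefix of a history. -/
def front {t : ℕ} (h : G.Hist (t + 1)) : G.Hist t :=
  (fun k => h.1 k.castSucc, fun k => h.2.1 k.castSucc, fun k => h.2.2 k.castSucc)

/-- `Pr(h_t | π̄)`: the product of the initial, transition, observation and policy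
probabilities along the history. -/
def histProb (π : G.JointPolicy) : (t : ℕ) → G.Hist t → ℝ
  | 0, h => G.ρ (h.1 0) * G.O0 (h.1 0) (h.2.1 0)
  | (t + 1), h =>
      histProb π t (G.front h) * G.polProb π (G.front h) (h.2.2 (Fin.last t)) *
        G.Tr (G.lastState (G.front h)) (h.2.2 (Fin.last t)) (G.lastState h) *
        G.Obs (G.lastState (G.front h)) (h.2.2 (Fin.last t)) (G.lastState h)
          (h.2.1 (Fin.last (t + 1)))

/-- Auxiliary (fuel-indexed) value recursion. -/
def valAux (π : G.JointPolicy) (i : Fin G.n) : ℕ → (t : ℕ) → G.Hist t → ℝ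
  | 0, _, _ => 0
  | (fuel + 1), t, h =>
      if t < G.T then
        ∑ a : G.JointAct, ∑ s' : G.S, ∑ z' : G.ObsTuple,
          G.polProb π h a * G.Tr (G.lastState h) a s' * G.Obs (G.lastState h) a s' z' *
            (G.R i (G.lastState h) a s' + G.γ * valAux π i fuel (t + 1) (G.extend h a s' z'))
      else 0

/-- `V^i_π̄(h_t) = E[ ∑_{k=t}^{T-1} γ^{k-t} R^i(s_k, ā_k, s_{k+1}) | h_t, π̄ ]`. -/
def V (π : G.JointPolicy) (i : Fin G.n) {t : ℕ} (h : G.Hist t) : ℝ :=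
  G.valAux π i (G.T - t) t h

/-- `Q^i_π̄(h_t, a^i)`: expected value conditioned on player `i` playing `a^i` at `h_t`
while the other players follow `π̄`. -/
def Q (π : G.JointPolicy) (i : Fin G.n) {t : ℕ} (h : G.Hist t) (ai : G.A) : ℝ :=
  if ht : t < G.T then
    ∑ a : G.JointAct, ∑ s' : G.S, ∑ z' : G.ObsTuple,
      (if a i = ai then ∏ j ∈ Finset.univ.erase i, π j ⟨t, ht⟩ (G.red j h) (a j) else 0) *
        G.Tr (G.lastState h) a s' * G.Obs (G.lastState h) a s' z' *
        (G.R i (G.lastState h) a s' + G.γ * G.V π i (G.extend h a s' z'))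
  else 0

/-- The advantage function `A^i_π̄(h_t, a^i) = Q^i_π̄(h_t, a^i) − V^i_π̄(h_t)`. -/
def Adv (π : G.JointPolicy) (i : Fin G.n) {t : ℕ} (h : G.Hist t) (ai : G.A) : ℝ :=
  G.Q π i h ai - G.V π i h

/-- The initial history determined by `s_0` and `z̄_0`. -/
def hist0 (s : G.S) (z : G.ObsTuple) : G.Hist 0 :=
  (fun _ => s, fun _ => z, fun k => k.elim0)

/-- The utility `u^i(π̄) = E_{h_0}[ V^i_π̄(h_0) ]`. -/
def u (π : G.JointPolicy) (i : Fin G.n) : ℝ :=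
  ∑ s : G.S, ∑ z : G.ObsTuple, G.ρ s * G.O0 s z * G.V π i (G.hist0 s z)

/-- `∑_{h_t ∈ x_t^i} Pr(h_t | π̄)`: reaching probability of an information set. -/
def reach (π : G.JointPolicy) (i : Fin G.n) {t : ℕ} (x : G.LocTraj i t) : ℝ :=
  ∑ h : G.Hist t, if G.red i h = x then G.histProb π t h else 0

/-- `∑_{h_t ∈ x_t^i} Pr(h_t | π̄) A^i_π̄(h_t, a)`. -/
def advW (π : G.JointPolicy) (i : Fin G.n) {t : ℕ} (x : G.LocTraj i t) (a : G.A) : ℝ :=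
  ∑ h : G.Hist t, if G.red i h = x then G.histProb π t h * G.Adv π i h a else 0

/-- The local advantage map `w`. -/
def w (π : G.JointPolicy) : G.Score :=
  fun i t x a => G.advW π i x a / G.reach π i x

/-- The regularized choice map `σ` (softmax with parameter `ε`). -/
def choice (ε : ℝ) (y : G.Score) : G.JointPolicy :=
  fun i t x a => softmax ε (y i t x) a

/-- Assumption: every local trajectory contains some history with positive probability
under fully mixed joint policies. -/
def ReachPos : Prop :=
  ∀ π : G.JointPolicy, G.IsJointPolicy π → G.FullyMixed π →
    ∀ (i : Fin G.n) (t : Fin G.T) (x : G.LocTraj i t.1), 0 < G.reach π i x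

/-- The discounted entropy-regularization term
`ε ∑_{t<T} γ^t ∑_{x_t^i} H(p(x_t^i)) ∑_{h_t ∈ x_t^i} Pr(h_t | π_reach)`. -/
def entReg (ε : ℝ) {i : Fin G.n} (p : G.Policy i) (πreach : G.JointPolicy) : ℝ :=
  ε * ∑ t : Fin G.T, G.γ ^ (t : ℕ) *
    ∑ x : G.LocTraj i t.1, negEnt (p t x) * G.reach πreach i x

/-- Nash distribution with modification-L (parameter `ε`). -/
def NashDistL (ε : ℝ) (πL : G.JointPolicy) : Prop :=
  ∀ (i : Fin G.n) (p : G.Policy i), G.IsPolicy p →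
    G.u πL i - G.entReg ε (πL i) πL ≥
      G.u (Function.update πL i p) i - G.entReg ε p πL

/-- Nash distribution with modification-R (parameter `ε`). -/
def NashDistR (ε : ℝ) (πR : G.JointPolicy) : Prop :=
  ∀ (i : Fin G.n) (p : G.Policy i), G.IsPolicy p →
    G.u πR i - G.entReg ε (πR i) (Function.update πR i p) ≥
      G.u (Function.update πR i p) i - G.entReg ε p (Function.update πR i p)

end POSG

theorem aux_negEnt_nonpos {α : Type*} [Fintype α] (p : α → ℝ) (h0 : ∀ a, 0 ≤ p a)
    (h1 : ∑ a, p a = 1) : negEnt p ≤ 0 := by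
  unfold negEnt
  apply Finset.sum_nonpos
  intro a _
  have : p a ≤ 1 := by
    rw [← h1]
    exact Finset.single_le_sum (fun b _ => h0 b) (Finset.mem_univ a)
  exact mul_nonpos_of_nonneg_of_nonpos (h0 a) (Real.log_nonpos (h0 a) this)

theorem aux_negEnt_ge {α : Type*} [Fintype α] [Nonempty α] (p : α → ℝ) (h0 : ∀ a, 0 ≤ p a)
    (h1 : ∑ a, p a = 1) : -Real.log (Fintype.card α) ≤ negEnt p := by
  have hN : (0 : ℝ) < Fintype.card α := by exact_mod_cast Fintype.card_pos
  have key : ∀ a, p a - (Fintype.card α : ℝ)⁻¹ - p a * Real.log (Fintype.card α)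
      ≤ p a * Real.log (p a) := by
    intro a
    rcases (h0 a).eq_or_lt with h | h
    · rw [← h]; simp
    · have h2 := Real.log_le_sub_one_of_pos (x := ((Fintype.card α : ℝ) * p a)⁻¹) (by positivity)
      rw [Real.log_inv, Real.log_mul hN.ne' h.ne'] at h2
      have h3 := mul_le_mul_of_nonneg_left h2 h.le
      have h4 : p a * (((Fintype.card α : ℝ) * p a)⁻¹ - 1) = (Fintype.card α : ℝ)⁻¹ - p a := by
        field_simp
      rw [h4] at h3
      linarith
  have hs := Finset.sum_le_sum (fun a (_ : a ∈ Finset.univ) => key a)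
  rw [Finset.sum_sub_distrib, Finset.sum_sub_distrib, ← Finset.sum_mul, h1] at hs
  simp only [Finset.sum_const, Finset.card_univ, nsmul_eq_mul] at hs
  rw [mul_inv_cancel₀ hN.ne'] at hs
  unfold negEnt
  linarith

namespace POSG

variable (G : POSG)

theorem aux_polProb_nonneg (π : G.JointPolicy) (hπ : G.IsJointPolicy π) {t : ℕ} (h : G.Hist t)
    (a : G.JointAct) : 0 ≤ G.polProb π h a := by
  unfold polProb
  split_ifs
  · exact Finset.prod_nonneg fun i _ => (hπ i).1 _ _ _
  · exact le_rfl

theorem aux_polProb_sum (π : G.JointPolicy) (hπ : G.IsJointPolicy π) {t : ℕ} (ht : t < G.T)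
    (h : G.Hist t) : ∑ a, G.polProb π h a = 1 := by
  simp only [polProb, ht, dif_pos]
  rw [← Fintype.prod_sum (fun i b => π i ⟨t, ht⟩ (G.red i h) b)]
  exact Finset.prod_eq_one fun i _ => (hπ i).2 _ _

theorem aux_histProb_nonneg (π : G.JointPolicy) (hπ : G.IsJointPolicy π) :
    ∀ (t : ℕ) (h : G.Hist t), 0 ≤ G.histProb π t h
  | 0, h => mul_nonneg (G.ρ_nonneg _) (G.O0_nonneg _ _)
  | (t + 1), h => by
      rw [histProb]
      exact mul_nonneg (mul_nonneg (mul_nonneg (aux_histProb_nonneg π hπ t _)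
        (G.aux_polProb_nonneg π hπ _ _)) (G.Tr_nonneg _ _ _)) (G.Obs_nonneg _ _ _ _)

def auxEquiv (t : ℕ) : G.Hist t × G.JointAct × G.S × G.ObsTuple ≃ G.Hist (t + 1) where
  toFun q := G.extend q.1 q.2.1 q.2.2.1 q.2.2.2
  invFun h := (G.front h, h.2.2 (Fin.last t), h.1 (Fin.last (t + 1)), h.2.1 (Fin.last (t + 1)))
  left_inv := by
    rintro ⟨⟨x, y, z⟩, a, s, o⟩
    simp [extend, front]
  right_inv := by
    rintro ⟨x, y, z⟩
    simp only [extend, front]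
    refine Prod.ext (Fin.snoc_init_self x) (Prod.ext ?_ ?_)
    · exact Fin.snoc_init_self y
    · exact Fin.snoc_init_self z

def auxEquiv0 : G.S × G.ObsTuple ≃ G.Hist 0 where
  toFun q := G.hist0 q.1 q.2
  invFun h := (h.1 0, h.2.1 0)
  left_inv := by
    rintro ⟨s, o⟩
    rfl
  right_inv := by
    rintro ⟨x, y, z⟩
    refine Prod.ext ?_ (Prod.ext ?_ ?_)
    · funext k; rw [show k = 0 from Fin.fin_one_eq_zero k]; rfl
    · funext k; rw [show k = 0 from Fin.fin_one_eq_zero k]; rfl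
    · funext k; exact k.elim0

theorem aux_histProb_extend (π : G.JointPolicy) (t : ℕ) (h : G.Hist t) (a : G.JointAct)
    (s : G.S) (z : G.ObsTuple) : G.histProb π (t + 1) (G.extend h a s z) =
      G.histProb π t h * (G.polProb π h a * (G.Tr (G.lastState h) a s *
        G.Obs (G.lastState h) a s z)) := by
  have hf : G.front (G.extend h a s z) = h := by
    simp [front, extend]
  rw [histProb, hf]
  simp [extend, lastState, mul_assoc]

theorem aux_histProb_sum (π : G.JointPolicy) (hπ : G.IsJointPolicy π) :
    ∀ (t : ℕ), t ≤ G.T → ∑ h, G.histProb π t h = 1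
  | 0, _ => by
      rw [← Equiv.sum_comp G.auxEquiv0, Fintype.sum_prod_type]
      simp only [auxEquiv0, Equiv.coe_fn_mk, histProb, hist0, ← Finset.mul_sum, G.O0_sum, mul_one,
        G.ρ_sum]
  | (t + 1), ht => by
      rw [← Equiv.sum_comp (G.auxEquiv t)]
      simp only [Fintype.sum_prod_type, auxEquiv, Equiv.coe_fn_mk, aux_histProb_extend,
        ← Finset.mul_sum, G.Obs_sum, mul_one, G.Tr_sum, G.aux_polProb_sum π hπ ht]
      have ih := aux_histProb_sum π hπ t (by omega)
      simpa only [Fintype.sum_prod_type] using ih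

theorem aux_reach_nonneg (π : G.JointPolicy) (hπ : G.IsJointPolicy π) (i : Fin G.n) {t : ℕ}
    (x : G.LocTraj i t) : 0 ≤ G.reach π i x := by
  unfold reach
  refine Finset.sum_nonneg fun h _ => ?_
  split_ifs
  · exact G.aux_histProb_nonneg π hπ t h
  · exact le_rfl

theorem aux_reach_sum (π : G.JointPolicy) (hπ : G.IsJointPolicy π) (i : Fin G.n) {t : ℕ}
    (ht : t ≤ G.T) : ∑ x : G.LocTraj i t, G.reach π i x = 1 := by
  unfold reach
  rw [Finset.sum_comm]
  simp only [Finset.sum_ite_eq, Finset.mem_univ, if_true]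
  exact G.aux_histProb_sum π hπ t ht

theorem aux_entReg_nonpos (ε : ℝ) (hε : 0 ≤ ε) {i : Fin G.n} (p : G.Policy i)
    (hp : G.IsPolicy p) (π : G.JointPolicy) (hπ : G.IsJointPolicy π) :
    G.entReg ε p π ≤ 0 := by
  unfold entReg
  refine mul_nonpos_of_nonneg_of_nonpos hε (Finset.sum_nonpos fun t _ => ?_)
  refine mul_nonpos_of_nonneg_of_nonpos (pow_nonneg G.γ_pos.le _) (Finset.sum_nonpos fun x _ => ?_)
  exact mul_nonpos_of_nonpos_of_nonneg (aux_negEnt_nonpos _ (hp.1 t x) (hp.2 t x))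
    (G.aux_reach_nonneg π hπ i x)

theorem aux_entReg_ge (ε : ℝ) (hε : 0 ≤ ε) {i : Fin G.n} (p : G.Policy i)
    (hp : G.IsPolicy p) (π : G.JointPolicy) (hπ : G.IsJointPolicy π) :
    -(ε * Real.log (Fintype.card G.A) * ∑ k ∈ Finset.range G.T, G.γ ^ k) ≤ G.entReg ε p π := by
  have : -(ε * Real.log (Fintype.card G.A) * ∑ k ∈ Finset.range G.T, G.γ ^ k) =
      ε * ∑ t : Fin G.T, G.γ ^ (t : ℕ) * (-Real.log (Fintype.card G.A)) := by
    rw [← Finset.sum_mul, Fin.sum_univ_eq_sum_range (fun k => G.γ ^ k)]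
    ring
  rw [this]
  unfold entReg
  refine mul_le_mul_of_nonneg_left (Finset.sum_le_sum fun t _ => ?_) hε
  refine mul_le_mul_of_nonneg_left ?_ (pow_nonneg G.γ_pos.le _)
  calc -Real.log (Fintype.card G.A)
      = ∑ x : G.LocTraj i t.1, -Real.log (Fintype.card G.A) * G.reach π i x := by
        rw [← Finset.mul_sum, G.aux_reach_sum π hπ i t.2.le, mul_one]
    _ ≤ _ := Finset.sum_le_sum fun x _ => mul_le_mul_of_nonneg_right
        (aux_negEnt_ge _ (hp.1 t x) (hp.2 t x)) (G.aux_reach_nonneg π hπ i x)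

end POSG

/-- **Deviation bound for modification-R Nash distributions.**  Every Nash distribution
`π̄_R` with modification-R (parameter `ε ≥ 0`) is an `ε'`-Nash equilibrium with
`ε' = ε · log|A| · ∑_{k=0}^{T-1} γ^k`. -/
theorem nashDistR_deviation_bound (G : POSG) (ε : ℝ) (hε : 0 ≤ ε)
    (πR : G.JointPolicy) (hπR : G.IsJointPolicy πR) (hR : G.NashDistR ε πR) :
    ∀ (i : Fin G.n) (p : G.Policy i), G.IsPolicy p →
      G.u (Function.update πR i p) i - G.u πR i ≤
        ε * Real.log (Fintype.card G.A) * ∑ k ∈ Finset.range G.T, G.γ ^ k := by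
  intro i p hp
  have hπ : G.IsJointPolicy (Function.update πR i p) := by
    intro j
    by_cases hj : j = i
    · subst hj; simpa using hp
    · simpa [Function.update_of_ne hj] using hπR j
  have h1 := hR i p hp
  have h2 := G.aux_entReg_nonpos ε hε p hp _ hπ
  have h3 := G.aux_entReg_ge ε hε (πR i) (hπR i) _ hπ
  linarith
end
end

section
/- Existence of an IESL rest point: Fix ε > 0. In any n-player finite-horizon imperfect-information game with simultaneous moves in which every local trajectory contains some history with positive probability under fully mixed joint policies, there exists a score ȳ_* with w(σ(ȳ_*)) = ȳ_*; that is, the composite map w ∘ σ from the score space to itself has a fixed point. -/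
open scoped Classical BigOperators

noncomputable section

section Brouwer

open MeasureTheory Polynomial in
theorem brw_interp (n : ℕ) (v : Fin (n+1) → ℝ) (hv : Function.Injective v)
    (A : EuclideanSpace ℝ (Fin n) →L[ℝ] EuclideanSpace ℝ (Fin n)) :
    (1 + A).det = ∑ j, (1 + v j • A).det * (Lagrange.basis Finset.univ v j).eval 1 := by
  let b := (EuclideanSpace.basisFun (Fin n) ℝ).toBasis
  let M : Matrix (Fin n) (Fin n) ℝ := LinearMap.toMatrix b b (A : _ →ₗ[ℝ] _)
  let p : ℝ[X] := Matrix.det ((X : ℝ[X]) • M.map C + (1 : Matrix (Fin n) (Fin n) ℝ).map C)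
  have hp : ∀ t : ℝ, p.eval t = (1 + t • A).det := by
    intro t
    have h1 : (1 + t • A).det = Matrix.det (1 + t • M) := by
      rw [ContinuousLinearMap.det, ← LinearMap.det_toMatrix b]
      congr 1
      simp [M]
    rw [h1]
    simp only [p]
    rw [← Polynomial.coe_evalRingHom, RingHom.map_det]
    congr 1
    ext i j
    simp [Matrix.one_apply]
    ring_nf
    split_ifs <;> simp
  have hdeg : p.degree < (Finset.univ : Finset (Fin (n+1))).card := by
    have := Polynomial.natDegree_det_X_add_C_le M 1
    refine lt_of_le_of_lt Polynomial.degree_le_natDegree ?_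
    simp only [Finset.card_univ, Fintype.card_fin] at this ⊢
    exact_mod_cast Nat.lt_succ_of_le this
  have hi := Lagrange.eq_interpolate_of_eval_eq (s := Finset.univ) (v := v) (f := p)
    (r := fun j => (1 + v j • A).det) hv.injOn hdeg (fun i _ => hp (v i))
  have h1 := hp 1
  rw [one_smul] at h1
  rw [← h1, hi, Lagrange.interpolate_apply, Polynomial.eval_finsetSum]
  simp

open MeasureTheory in
theorem brw_noRetract (n : ℕ) (R : ℝ) (hR : 0 < R)
    (r : EuclideanSpace ℝ (Fin n) → EuclideanSpace ℝ (Fin n)) (hr : ContDiff ℝ 1 r)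
    (hn : ∀ x, ‖r x‖ = R) (hid : ∀ x, ‖x‖ = R → r x = x) : False := by
  let E := EuclideanSpace ℝ (Fin n)
  let B : Set E := Metric.closedBall 0 R
  have hBc : IsCompact B := isCompact_closedBall 0 R
  have memB : ∀ x : E, x ∈ B ↔ ‖x‖ ≤ R := fun x => by simp [B]
  let h : E → E := fun x => r x - x
  have hh : ContDiff ℝ 1 h := hr.sub contDiff_id
  obtain ⟨K, hK⟩ := (hh.contDiffOn (s := B)).exists_lipschitzOnWith one_ne_zero
    (convex_closedBall 0 R) hBc
  have hK' : ∀ x, ‖x‖ ≤ R → ∀ y, ‖y‖ ≤ R → ‖h x - h y‖ ≤ K * ‖x - y‖ := fun x hx y hy =>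
    hK.norm_sub_le ((memB x).2 hx) ((memB y).2 hy)
  have hz : ∀ x, ‖x‖ = R → h x = 0 := fun x hx => by simp [h, hid x hx]
  let k : E → E := fun x => if ‖x‖ ≤ R then h x else 0
  -- mixed estimate
  have hmix : ∀ x, ‖x‖ ≤ R → ∀ y, ¬ ‖y‖ ≤ R → ‖h x‖ ≤ (2 * K) * ‖x - y‖ := by
    intro x hx y hy
    push Not at hy
    have hy0 : 0 < ‖y‖ := hR.trans hy
    let z : E := (R / ‖y‖) • y
    have hzn : ‖z‖ = R := by
      simp only [z, norm_smul, Real.norm_eq_abs, abs_of_pos (div_pos hR hy0)]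
      field_simp
    have hyz : ‖y - z‖ ≤ ‖x - y‖ := by
      have : y - z = (1 - R / ‖y‖) • y := by simp [z, sub_smul]
      have h1 : 0 ≤ 1 - R / ‖y‖ := by
        rw [sub_nonneg, div_le_one hy0]; exact hy.le
      rw [this, norm_smul, Real.norm_eq_abs, abs_of_nonneg h1, sub_mul, div_mul_cancel₀ _ hy0.ne']
      have := norm_sub_norm_le y x
      rw [norm_sub_rev] at this
      linarith
    have hxz : ‖x - z‖ ≤ 2 * ‖x - y‖ := by
      have := norm_sub_le_norm_sub_add_norm_sub x y z
      linarith
    have := hK' x hx z hzn.le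
    rw [hz z hzn, sub_zero] at this
    calc ‖h x‖ ≤ K * ‖x - z‖ := this
      _ ≤ K * (2 * ‖x - y‖) := by gcongr
      _ = _ := by ring
  have hk : ∀ x y, ‖k x - k y‖ ≤ (2 * K) * ‖x - y‖ := by
    intro x y
    by_cases hx : ‖x‖ ≤ R <;> by_cases hy : ‖y‖ ≤ R
    · simp only [k, hx, hy, if_true]
      refine (hK' x hx y hy).trans ?_
      have : (0:ℝ) ≤ K * ‖x - y‖ := by positivity
      linarith
    · simp only [k, hx, hy, if_true, if_false, sub_zero]
      exact hmix x hx y hy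
    · simp only [k, hx, hy, if_true, if_false, zero_sub, norm_neg]
      rw [norm_sub_rev x y]
      exact hmix y hy x hx
    · simp only [k, hx, hy, if_false, sub_zero, norm_zero]; positivity
  let A : E → (E →L[ℝ] E) := fun x => fderiv ℝ h x
  have hA : Continuous A := hh.continuous_fderiv one_ne_zero
  have hdetc : ∀ t : ℝ, Continuous (fun x => (1 + t • A x).det) := fun t =>
    ContinuousLinearMap.continuous_det.comp (by fun_prop)
  -- positivity of the determinant
  obtain ⟨C, hC⟩ := hBc.exists_bound_of_continuousOn hA.continuousOn
  have hdpos : ∃ δ > 0, ∀ M : E →L[ℝ] E, ‖M‖ < δ → 0 < (1 + M).det := by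
    have hc : ContinuousAt (fun M : E →L[ℝ] E => (1 + M).det) 0 :=
      (ContinuousLinearMap.continuous_det.comp (by fun_prop)).continuousAt
    have h0 : (0:ℝ) < (fun M : E →L[ℝ] E => (1 + M).det) 0 := by
      simp [ContinuousLinearMap.det]
    have := hc.eventually (lt_mem_nhds h0)
    rw [Metric.eventually_nhds_iff] at this
    obtain ⟨δ, hδ, H⟩ := this
    exact ⟨δ, hδ, fun M hM => H (by simpa using hM)⟩
  obtain ⟨δ, hδ, hdet⟩ := hdpos
  have hC1 : 0 < |C| + 1 := by positivity
  have key : ∀ t : ℝ, 0 < t → t < 1 → t * (2 * K) < 1 → t * (|C| + 1) < δ →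
      ∫ x in B, (1 + t • A x).det = (volume B).toReal := by
    intro t ht0 ht1 htK htC
    let φ : E → E := fun x => x + t • h x
    have hinj : Set.InjOn φ B := by
      intro x hx y hy hxy
      have h1 : x - y = - (t • (h x - h y)) := by
        have : x + t • h x = y + t • h y := hxy
        rw [smul_sub]
        have h2 : x = y + t • h y - t • h x := by rw [← this]; abel
        nth_rewrite 1 [h2]; abel
      have h2 : ‖x - y‖ ≤ t * (K * ‖x - y‖) := by
        calc ‖x - y‖ = t * ‖h x - h y‖ := by
              conv_lhs => rw [h1]
              rw [norm_neg, norm_smul, Real.norm_eq_abs, abs_of_pos ht0]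
          _ ≤ _ := by gcongr; exact hK' x ((memB x).1 hx) y ((memB y).1 hy)
      have h3 : ‖x - y‖ = 0 := by
        by_contra hne
        have hp : 0 < ‖x - y‖ := lt_of_le_of_ne (norm_nonneg _) (Ne.symm hne)
        have hKn : (0:ℝ) ≤ K := K.2
        nlinarith [mul_nonneg ht0.le hKn]
      exact sub_eq_zero.1 (norm_eq_zero.1 h3)
    have himg : φ '' B = B := by
      apply Set.Subset.antisymm
      · rintro _ ⟨x, hx, rfl⟩
        rw [memB] at hx ⊢
        have : φ x = (1 - t) • x + t • r x := by
          simp only [φ, h, smul_sub, sub_smul, one_smul]; abel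
        rw [this]
        calc _ ≤ ‖(1 - t) • x‖ + ‖t • r x‖ := norm_add_le _ _
          _ = (1 - t) * ‖x‖ + t * R := by
            rw [norm_smul, norm_smul, hn, Real.norm_eq_abs, Real.norm_eq_abs, abs_of_pos ht0,
              abs_of_pos (by linarith)]
          _ ≤ R := by nlinarith
      · intro y hy
        have hcon : ContractingWith (t.toNNReal * (2 * K)) (fun x => y - t • k x) := by
          constructor
          · rw [← NNReal.coe_lt_coe]; simpa [Real.coe_toNNReal t ht0.le] using htK
          · apply LipschitzWith.of_dist_le_mul
            intro a b
            rw [dist_eq_norm, dist_eq_norm, sub_sub_sub_cancel_left, ← smul_sub, norm_smul,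
              Real.norm_eq_abs, abs_of_pos ht0]
            have := hk b a
            rw [norm_sub_rev b a] at this
            calc t * ‖k b - k a‖ ≤ t * (2 * K * ‖a - b‖) := by gcongr
              _ = _ := by simp [mul_assoc, Real.coe_toNNReal t ht0.le]
        have hfix := hcon.fixedPoint_isFixedPt
        set x := ContractingWith.fixedPoint _ hcon
        have hx : y - t • k x = x := hfix
        have hy' := (memB y).1 hy
        have hxB : ‖x‖ ≤ R := by
          by_contra hne
          have : k x = 0 := by simp only [k, hne, if_false]
          rw [this, smul_zero, sub_zero] at hx
          exact hne (hx ▸ hy')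
        refine ⟨x, (memB x).2 hxB, ?_⟩
        have : k x = h x := by simp only [k, hxB, if_true]
        rw [this] at hx
        simp only [φ]
        nth_rewrite 1 [← hx]
        abel
    have hder : ∀ x ∈ B, HasFDerivWithinAt φ (1 + t • A x) B x := by
      intro x _
      have h1 : HasFDerivAt h (A x) x := (hh.differentiable one_ne_zero x).hasFDerivAt
      exact ((hasFDerivAt_id x).add (h1.const_smul t)).hasFDerivWithinAt
    have hpos : ∀ x ∈ B, 0 < (1 + t • A x).det := by
      intro x hx
      apply hdet
      rw [norm_smul, Real.norm_eq_abs, abs_of_pos ht0]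
      refine lt_of_le_of_lt ?_ htC
      gcongr
      exact (hC x hx).trans ((le_abs_self C).trans (by linarith))
    have hBm : MeasurableSet B := hBc.measurableSet
    have hcv := integral_image_eq_integral_abs_det_fderiv_smul volume hBm hder hinj
      (fun _ => (1:ℝ))
    rw [himg] at hcv
    simp only [smul_eq_mul, mul_one, integral_const, MeasurableSet.univ,
      measureReal_restrict_apply, Set.univ_inter] at hcv
    rw [← measureReal_def, hcv]
    apply setIntegral_congr_fun hBm
    intro x hx
    exact (abs_of_pos (hpos x hx)).symm
  -- nodes
  obtain ⟨t0, ht0, ht01, ht02, ht03⟩ : ∃ t0 : ℝ, 0 < t0 ∧ t0 ≤ 1 ∧ t0 * (2 * K) ≤ 1 ∧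
      t0 * (|C| + 1) ≤ δ := by
    have hKn : (0:ℝ) ≤ K := K.2
    refine ⟨min 1 (min (1 / (2 * K + 1)) (δ / (|C| + 1))), by positivity, min_le_left _ _, ?_, ?_⟩
    · have : min 1 (min (1 / (2 * (K:ℝ) + 1)) (δ / (|C| + 1))) ≤ 1 / (2 * (K:ℝ) + 1) :=
        (min_le_right _ _).trans (min_le_left _ _)
      rw [le_div_iff₀ (by positivity)] at this
      have h2 : 0 < min 1 (min (1 / (2 * (K:ℝ) + 1)) (δ / (|C| + 1))) := by positivity
      linarith
    · have : min 1 (min (1 / (2 * (K:ℝ) + 1)) (δ / (|C| + 1))) ≤ δ / (|C| + 1) :=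
        (min_le_right _ _).trans (min_le_right _ _)
      rwa [le_div_iff₀ (by positivity)] at this
  let v : Fin (n+1) → ℝ := fun j => t0 / ((j:ℝ) + 2)
  have hv : Function.Injective v := by
    intro i j hij
    simp only [v] at hij
    rw [div_eq_div_iff (by positivity) (by positivity)] at hij
    have := mul_left_cancel₀ ht0.ne' hij
    have h2 : (i:ℝ) = (j:ℝ) := by linarith
    exact Fin.ext (by exact_mod_cast h2)
  have hv0 : ∀ j, 0 < v j := fun j => by positivity
  have hv1 : ∀ j, v j < t0 := fun j => by
    simp only [v]
    rw [div_lt_iff₀ (by positivity)]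
    have : (0:ℝ) ≤ (j:ℝ) := by positivity
    nlinarith
  have hvi : ∀ j, ∫ x in B, (1 + v j • A x).det = (volume B).toReal := by
    intro j
    have hKn : (0:ℝ) ≤ K := K.2
    apply key _ (hv0 j) ((hv1 j).trans_le ht01)
    · rcases hKn.eq_or_lt with h0 | h0
      · rw [← h0]; norm_num
      · exact (mul_lt_mul_of_pos_right (hv1 j) (by positivity)).trans_le ht02
    · exact (mul_lt_mul_of_pos_right (hv1 j) hC1).trans_le ht03
  have hint : ∀ j, Integrable (fun x => (1 + v j • A x).det) (volume.restrict B) := fun j =>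
    ((hdetc (v j)).continuousOn).integrableOn_compact hBc
  have hsum : ∑ j, (Lagrange.basis Finset.univ v j).eval 1 = 1 := by
    rw [← Polynomial.eval_finsetSum, Lagrange.sum_basis hv.injOn Finset.univ_nonempty,
      Polynomial.eval_one]
  have hone : ∫ x in B, (1 + A x).det = (volume B).toReal := by
    have : ∀ x, (1 + A x).det =
        ∑ j, (1 + v j • A x).det * (Lagrange.basis Finset.univ v j).eval 1 :=
      fun x => brw_interp n v hv (A x)
    simp_rw [this]
    rw [integral_finsetSum _ (fun j _ => (hint j).mul_const _)]
    simp_rw [integral_mul_const, hvi]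
    rw [← Finset.mul_sum, hsum, mul_one]
  have hzero : ∀ x, (1 + A x).det = 0 := by
    intro x
    have hrd : HasFDerivAt r (fderiv ℝ r x) x := (hr.differentiable one_ne_zero x).hasFDerivAt
    have hAe : 1 + A x = fderiv ℝ r x := by
      have : HasFDerivAt h (fderiv ℝ r x - ContinuousLinearMap.id ℝ E) x :=
        hrd.sub (hasFDerivAt_id x)
      have h2 : A x = _ := this.fderiv
      rw [h2]
      ext1 v
      simp
    rw [hAe]
    by_contra hne
    have hcd : HasFDerivAt (fun y => ‖r y‖ ^ 2) (0 : E →L[ℝ] ℝ) x := by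
      simp_rw [hn]; exact hasFDerivAt_const _ _
    have hcd2 := hrd.norm_sq
    have heq := hcd2.unique hcd
    have hbij : Function.Surjective (fderiv ℝ r x) := by
      have hu : IsUnit (LinearMap.det ((fderiv ℝ r x : E →L[ℝ] E) : E →ₗ[ℝ] E)) :=
        isUnit_iff_ne_zero.2 hne
      exact (LinearEquiv.ofIsUnitDet (v := (EuclideanSpace.basisFun (Fin n) ℝ).toBasis) (v' := (EuclideanSpace.basisFun (Fin n) ℝ).toBasis) (f := ((fderiv ℝ r x : E →L[ℝ] E) : E →ₗ[ℝ] E)) (by rw [LinearMap.det_toMatrix]; exact hu)).surjective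
    obtain ⟨u, hu⟩ := hbij (r x)
    have := congrArg (fun L : E →L[ℝ] ℝ => L u) heq
    simp [hu, hn] at this
    exact hR.ne' this
  simp_rw [hzero] at hone
  simp only [integral_zero] at hone
  have hvol : 0 < (volume B).toReal :=
    ENNReal.toReal_pos (Metric.measure_closedBall_pos volume 0 hR).ne' hBc.measure_lt_top.ne
  exact hvol.ne hone

theorem brw_euclid (n : ℕ) (F : EuclideanSpace ℝ (Fin n) → EuclideanSpace ℝ (Fin n))
    (hF : ContDiff ℝ 1 F) (C : ℝ) (hC : ∀ x, ‖F x‖ ≤ C) : ∃ x, F x = x := by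
  by_contra hno
  push Not at hno
  have hC0 : 0 ≤ C := (norm_nonneg _).trans (hC 0)
  let χ : ContDiffBump (0 : EuclideanSpace ℝ (Fin n)) := ⟨C + 1, C + 2, by linarith, by linarith⟩
  let g : EuclideanSpace ℝ (Fin n) → EuclideanSpace ℝ (Fin n) := fun x => x - χ x • F x
  have hg : ContDiff ℝ 1 g := contDiff_id.sub (χ.contDiff.smul hF)
  have hg0 : ∀ x, g x ≠ 0 := by
    intro x hx
    have hx' : x = χ x • F x := sub_eq_zero.1 hx
    by_cases hxC : ‖x‖ ≤ C + 1
    · have : χ x = 1 := χ.one_of_mem_closedBall (by simpa [χ] using hxC)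
      rw [this, one_smul] at hx'
      exact hno x hx'.symm
    · have : ‖x‖ ≤ C := by
        calc ‖x‖ = ‖χ x • F x‖ := congrArg _ hx'
          _ = χ x * ‖F x‖ := by rw [norm_smul, Real.norm_eq_abs, abs_of_nonneg χ.nonneg]
          _ ≤ 1 * C := mul_le_mul χ.le_one (hC x) (norm_nonneg _) zero_le_one
          _ = C := one_mul _
      linarith
  have hR : 0 < C + 2 := by linarith
  refine brw_noRetract n (C + 2) hR (fun x => ((C + 2) / ‖g x‖) • g x) ?_ ?_ ?_
  · exact (contDiff_const.div (hg.norm ℝ hg0) (fun x => norm_ne_zero_iff.2 (hg0 x))).smul hg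
  · intro x
    have := norm_pos_iff.2 (hg0 x)
    rw [norm_smul, Real.norm_eq_abs, abs_of_pos (by positivity)]
    field_simp
  · intro x hx
    have h0 : χ x = 0 := χ.zero_of_le_dist (by simp [χ, hx])
    have : g x = x := by simp [g, h0]
    simp only [this, hx, div_self hR.ne', one_smul]

theorem brw_fixed {V : Type*} [NormedAddCommGroup V] [NormedSpace ℝ V] [FiniteDimensional ℝ V]
    (F : V → V) (hF : ContDiff ℝ 1 F) (C : ℝ) (hC : ∀ x, ‖F x‖ ≤ C) : ∃ x, F x = x := by
  let e : V ≃L[ℝ] EuclideanSpace ℝ (Fin (Module.finrank ℝ V)) := toEuclidean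
  obtain ⟨x, hx⟩ := brw_euclid _ (fun x => e (F (e.symm x)))
    (e.contDiff.comp (hF.comp e.symm.contDiff))
    (‖(e : V →L[ℝ] EuclideanSpace ℝ (Fin (Module.finrank ℝ V)))‖ * C) (fun x =>
      ((e : V →L[ℝ] EuclideanSpace ℝ (Fin (Module.finrank ℝ V))).le_opNorm _).trans
        (mul_le_mul_of_nonneg_left (hC _) (norm_nonneg _)))
  exact ⟨e.symm x, by apply e.injective; simpa using hx⟩

end Brouwer

namespace POSG

variable (G : POSG)

theorem cd_eval (i : Fin G.n) (t : Fin G.T) (x : G.LocTraj i t.1) (a : G.A) :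
    ContDiff ℝ 1 (fun π : G.JointPolicy => π i t x a) := by
  have h1 := contDiff_pi.1 (contDiff_id (𝕜 := ℝ) (n := 1) (E := G.JointPolicy)) i
  have h2 := contDiff_pi.1 h1 t
  have h3 := contDiff_pi.1 h2 x
  exact contDiff_pi.1 h3 a

theorem cd_polProb {t : ℕ} (h : G.Hist t) (a : G.JointAct) :
    ContDiff ℝ 1 (fun π : G.JointPolicy => G.polProb π h a) := by
  unfold polProb
  split_ifs with ht
  · exact contDiff_prod (fun i _ => G.cd_eval i ⟨t, ht⟩ _ _)
  · exact contDiff_const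

theorem cd_histProb (t : ℕ) : ∀ h : G.Hist t,
    ContDiff ℝ 1 (fun π : G.JointPolicy => G.histProb π t h) := by
  induction t with
  | zero => intro h; exact contDiff_const
  | succ t ih =>
    intro h
    simp only [histProb]
    exact (((ih _).mul (G.cd_polProb _ _)).mul contDiff_const).mul contDiff_const

theorem cd_valAux (i : Fin G.n) (f : ℕ) : ∀ (t : ℕ) (h : G.Hist t),
    ContDiff ℝ 1 (fun π : G.JointPolicy => G.valAux π i f t h) := by
  induction f with
  | zero => intro t h; exact contDiff_const
  | succ f ih =>
    intro t h
    simp only [valAux]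
    split_ifs with ht
    · refine ContDiff.sum fun a _ => ContDiff.sum fun s _ => ContDiff.sum fun z _ => ?_
      exact (((G.cd_polProb _ _).mul contDiff_const).mul contDiff_const).mul
        (contDiff_const.add (contDiff_const.mul (ih _ _)))
    · exact contDiff_const

theorem cd_Adv (i : Fin G.n) {t : ℕ} (h : G.Hist t) (a : G.A) :
    ContDiff ℝ 1 (fun π : G.JointPolicy => G.Adv π i h a) := by
  unfold Adv
  refine ContDiff.sub ?_ (G.cd_valAux i _ _ _)
  unfold Q
  split_ifs with ht
  · refine ContDiff.sum fun b _ => ContDiff.sum fun s _ => ContDiff.sum fun z _ => ?_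
    refine ((ContDiff.mul ?_ contDiff_const).mul contDiff_const).mul
        (contDiff_const.add (contDiff_const.mul (G.cd_valAux i _ _ _)))
    split_ifs
    · exact contDiff_prod (fun j _ => G.cd_eval j ⟨t, ht⟩ _ _)
    · exact contDiff_const
  · exact contDiff_const

theorem cd_reach (i : Fin G.n) {t : ℕ} (x : G.LocTraj i t) :
    ContDiff ℝ 1 (fun π : G.JointPolicy => G.reach π i x) := by
  unfold reach
  refine ContDiff.sum fun h _ => ?_
  split_ifs
  · exact G.cd_histProb _ _
  · exact contDiff_const

theorem cd_advW (i : Fin G.n) {t : ℕ} (x : G.LocTraj i t) (a : G.A) :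
    ContDiff ℝ 1 (fun π : G.JointPolicy => G.advW π i x a) := by
  unfold advW
  refine ContDiff.sum fun h _ => ?_
  split_ifs
  · exact (G.cd_histProb _ _).mul (G.cd_Adv _ _ _)
  · exact contDiff_const

theorem softmax_den_pos (ε : ℝ) (y : G.A → ℝ) : 0 < ∑ b, Real.exp (y b / ε) :=
  Finset.sum_pos (fun b _ => Real.exp_pos _) Finset.univ_nonempty

theorem cd_choice (ε : ℝ) : ContDiff ℝ 1 (G.choice ε) := by
  refine contDiff_pi.2 fun i => contDiff_pi.2 fun t => contDiff_pi.2 fun x =>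
    contDiff_pi.2 fun a => ?_
  have he : ∀ b, ContDiff ℝ 1 (fun y : G.Score => Real.exp (y i t x b / ε)) := fun b =>
    ((G.cd_eval i t x b).div_const ε).exp
  exact (he a).div (ContDiff.sum fun b _ => he b) (fun y => (G.softmax_den_pos ε (y i t x)).ne')

theorem choice_pos (ε : ℝ) (y : G.Score) : G.FullyMixed (G.choice ε y) := fun _ _ _ _ =>
  div_pos (Real.exp_pos _) (G.softmax_den_pos ε _)

theorem choice_isPolicy (ε : ℝ) (y : G.Score) : G.IsJointPolicy (G.choice ε y) := by
  intro i
  refine ⟨fun t x a => (G.choice_pos ε y i t x a).le, fun t x => ?_⟩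
  simp only [choice, softmax]
  rw [← Finset.sum_div, div_self (G.softmax_den_pos ε _).ne']

theorem histProb_nonneg (π : G.JointPolicy) (hπ : ∀ i t x a, 0 ≤ π i t x a) (t : ℕ) :
    ∀ h : G.Hist t, 0 ≤ G.histProb π t h := by
  induction t with
  | zero => intro h; exact mul_nonneg (G.ρ_nonneg _) (G.O0_nonneg _ _)
  | succ t ih =>
    intro h
    simp only [histProb]
    refine mul_nonneg (mul_nonneg (mul_nonneg (ih _) ?_) (G.Tr_nonneg _ _ _)) (G.Obs_nonneg _ _ _ _)
    unfold polProb
    split_ifs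
    · exact Finset.prod_nonneg fun i _ => hπ _ _ _ _
    · exact le_rfl

theorem policy_le_one (π : G.JointPolicy) (hπ : G.IsJointPolicy π) (i t x a) :
    π i t x a ≤ 1 := by
  rw [← (hπ i).2 t x]
  exact Finset.single_le_sum (f := fun a => π i t x a) (fun b _ => (hπ i).1 t x b)
    (Finset.mem_univ a)

theorem Adv_bdd (i : Fin G.n) {t : ℕ} (h : G.Hist t) (a : G.A) :
    ∃ C, ∀ π : G.JointPolicy, G.IsJointPolicy π → |G.Adv π i h a| ≤ C := by
  have hc : IsCompact (Set.Icc (fun _ _ _ _ => 0 : G.JointPolicy) (fun _ _ _ _ => 1)) :=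
    isCompact_Icc
  obtain ⟨C, hC⟩ := hc.exists_bound_of_continuousOn (G.cd_Adv i h a).continuous.continuousOn
  exact ⟨C, fun π hπ => hC π ⟨fun i t x a => (hπ i).1 t x a,
    fun i t x a => G.policy_le_one π hπ i t x a⟩⟩

theorem w_bdd (hreach : G.ReachPos) (i : Fin G.n) (t : Fin G.T) (x : G.LocTraj i t.1) (a : G.A) :
    ∃ C, 0 ≤ C ∧ ∀ π : G.JointPolicy, G.IsJointPolicy π → G.FullyMixed π → |G.w π i t x a| ≤ C := by
  choose C hC using fun h : G.Hist t.1 => G.Adv_bdd i h a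
  have hs : ∀ h, |C h| ≤ ∑ h', |C h'| := fun h =>
    Finset.single_le_sum (f := fun h => |C h|) (fun _ _ => abs_nonneg _) (Finset.mem_univ h)
  refine ⟨∑ h, |C h|, Finset.sum_nonneg fun _ _ => abs_nonneg _, fun π hπ hm => ?_⟩
  have hr := hreach π hπ hm i t x
  simp only [w]
  rw [abs_div, abs_of_pos hr, div_le_iff₀ hr]
  unfold advW reach
  rw [Finset.mul_sum]
  refine (Finset.abs_sum_le_sum_abs _ _).trans (Finset.sum_le_sum fun h _ => ?_)
  split_ifs
  · have h0 := G.histProb_nonneg π (fun i t x a => (hπ i).1 t x a) t.1 h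
    rw [abs_mul, abs_of_nonneg h0, mul_comm]
    exact mul_le_mul_of_nonneg_right ((hC h π hπ).trans ((le_abs_self _).trans (hs h))) h0
  · simp

end POSG

/-- **Existence of an IESL rest point.**  For every `ε > 0` the composite map
`w ∘ σ` from the score space to itself has a fixed point. -/
theorem exists_iesl_rest_point (G : POSG) (hreach : G.ReachPos) (ε : ℝ) (hε : 0 < ε) :
    ∃ y : G.Score, G.w (G.choice ε y) = y := by
  choose C hC0 hC using G.w_bdd hreach
  have hc := G.cd_choice ε
  have hF : ContDiff ℝ 1 (fun y : G.Score => G.w (G.choice ε y)) := by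
    refine contDiff_pi.2 fun i => contDiff_pi.2 fun t => contDiff_pi.2 fun x =>
      contDiff_pi.2 fun a => ?_
    exact ((G.cd_advW i x a).comp hc).div ((G.cd_reach i x).comp hc)
      (fun y => (hreach _ (G.choice_isPolicy ε y) (G.choice_pos ε y) i t x).ne')
  refine brw_fixed _ hF (∑ i, ∑ t, ∑ x, ∑ a, C i t x a) fun y => ?_
  have hn : ∀ i t x, 0 ≤ ∑ a, C i t x a := fun i t x => Finset.sum_nonneg fun a _ => hC0 i t x a
  have hn2 : ∀ i t, 0 ≤ ∑ x, ∑ a, C i t x a := fun i t => Finset.sum_nonneg fun x _ => hn i t x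
  have hn3 : ∀ i, 0 ≤ ∑ t, ∑ x, ∑ a, C i t x a := fun i => Finset.sum_nonneg fun t _ => hn2 i t
  refine (pi_norm_le_iff_of_nonneg (Finset.sum_nonneg fun i _ => hn3 i)).2 fun i => ?_
  refine le_trans ?_ (Finset.single_le_sum (fun i _ => hn3 i) (Finset.mem_univ i))
  refine (pi_norm_le_iff_of_nonneg (hn3 i)).2 fun t => ?_
  refine le_trans ?_ (Finset.single_le_sum (fun t _ => hn2 i t) (Finset.mem_univ t))
  refine (pi_norm_le_iff_of_nonneg (hn2 i t)).2 fun x => ?_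
  refine le_trans ?_ (Finset.single_le_sum (fun x _ => hn i t x) (Finset.mem_univ x))
  refine (pi_norm_le_iff_of_nonneg (hn i t x)).2 fun a => ?_
  refine le_trans ?_ (Finset.single_le_sum (fun a _ => hC0 i t x a) (Finset.mem_univ a))
  exact hC i t x a _ (G.choice_isPolicy ε y) (G.choice_pos ε y)
end
end

section
/- Lyapunov inequality for the IESL dynamic (core estimate of Theorem 3): Fix ε > 0, η > 0, a rest point ȳ_ε with w(σ(ȳ_ε)) = ȳ_ε and π̄_ε = σ(ȳ_ε), and a policy set Π_local containing π̄_ε on which the game is locally μ-hypomonotone about π̄_ε. Let y(t) be a differentiable solution of ẏ = η(w(σ(y)) − y) and define the energy E(t) = Σ_{i∈N} Σ_{x^i} [ ε log( Σ_b exp(y^i(t)(x^i,b)/ε) ) + ε H(π_ε^i(x^i)) − Σ_a π_ε^i(x^i,a) y^i(t)(x^i,a) ]. Then at every time t with σ(y(t)) ∈ Π_local, E is differentiable and Ė(t) ≤ η (μ − ε) Σ_{i∈N} Σ_{x^i, a} ( σ^i(y^i(t))(x^i, a) − π_ε^i(x^i, a) )². In particular, if μ < ε then Ė(t) ≤ 0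 at such times. -/
open scoped Classical BigOperators

noncomputable section

namespace POSG

variable (G : POSG)

/-- The energy (sum of Fenchel couplings over all information sets):
`E = ∑_i ∑_{x^i} [ ε log(∑_b exp(y^i(x^i,b)/ε)) + ε H(π_ε^i(x^i))
     − ∑_a π_ε^i(x^i,a) y^i(x^i,a) ]`. -/
def energy (ε : ℝ) (πε : G.JointPolicy) (y : G.Score) : ℝ :=
  ∑ i : Fin G.n, ∑ t : Fin G.T, ∑ x : G.LocTraj i t.1,
    (ε * Real.log (∑ b : G.A, Real.exp (y i t x b / ε)) + ε * negEnt (πε i t x) -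
      ∑ a : G.A, πε i t x a * y i t x a)

end POSG

theorem sm_aux_log {p q : ℝ} (hp : 0 < p) (hq : 0 < q) (hq1 : q ≤ 1) (h : p ≤ q) :
    (q - p) ^ 2 ≤ (q - p) * (Real.log q - Real.log p) := by
  have h1 : Real.log (p / q) ≤ p / q - 1 := Real.log_le_sub_one_of_pos (div_pos hp hq)
  rw [Real.log_div hp.ne' hq.ne'] at h1
  have h2 : p / q ≤ 1 - (q - p) := by
    rw [div_le_iff₀ hq]
    nlinarith [mul_nonneg (sub_nonneg.2 h) (sub_nonneg.2 hq1)]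
  rw [sq]
  exact mul_le_mul_of_nonneg_left (by linarith) (by linarith)

theorem sm_aux_log' {p q : ℝ} (hp : 0 < p) (hp1 : p ≤ 1) (hq : 0 < q) (hq1 : q ≤ 1) :
    (q - p) ^ 2 ≤ (q - p) * (Real.log q - Real.log p) := by
  rcases le_total p q with h | h
  · exact sm_aux_log hp hq hq1 h
  · have := sm_aux_log hq hp hp1 h
    nlinarith

theorem sm_Zpos {α : Type*} [Fintype α] [Nonempty α] (ε : ℝ) (y : α → ℝ) :
    0 < ∑ b, Real.exp (y b / ε) :=
  Finset.sum_pos (fun _ _ => Real.exp_pos _) Finset.univ_nonempty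

theorem sm_pos {α : Type*} [Fintype α] [Nonempty α] (ε : ℝ) (y : α → ℝ) (a : α) :
    0 < softmax ε y a := div_pos (Real.exp_pos _) (sm_Zpos ε y)

theorem sm_sum {α : Type*} [Fintype α] [Nonempty α] (ε : ℝ) (y : α → ℝ) :
    ∑ a, softmax ε y a = 1 := by
  unfold softmax
  rw [← Finset.sum_div]
  exact div_self (sm_Zpos ε y).ne'

theorem sm_le_one {α : Type*} [Fintype α] [Nonempty α] (ε : ℝ) (y : α → ℝ) (a : α) :
    softmax ε y a ≤ 1 := by
  rw [← sm_sum ε y]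
  exact Finset.single_le_sum (f := softmax ε y) (fun b _ => (sm_pos ε y b).le) (Finset.mem_univ a)

theorem sm_log {α : Type*} [Fintype α] [Nonempty α] (ε : ℝ) (hε : 0 < ε) (y : α → ℝ) (a : α) :
    y a = ε * Real.log (softmax ε y a) + ε * Real.log (∑ b, Real.exp (y b / ε)) := by
  unfold softmax
  rw [Real.log_div (Real.exp_pos _).ne' (sm_Zpos ε y).ne', Real.log_exp]
  field_simp
  ring

theorem sm_mono {α : Type*} [Fintype α] [Nonempty α] (ε : ℝ) (hε : 0 < ε) (y z : α → ℝ) :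
    ε * ∑ a, (softmax ε y a - softmax ε z a) ^ 2 ≤
      ∑ a, (softmax ε y a - softmax ε z a) * (y a - z a) := by
  have h : ∑ a, (softmax ε y a - softmax ε z a) * (y a - z a) =
      ε * ∑ a, (softmax ε y a - softmax ε z a) *
        (Real.log (softmax ε y a) - Real.log (softmax ε z a)) := by
    have h0 : ∑ a, (softmax ε y a - softmax ε z a) *
        (ε * Real.log (∑ b, Real.exp (y b / ε)) - ε * Real.log (∑ b, Real.exp (z b / ε))) = 0 := by
      rw [← Finset.sum_mul, Finset.sum_sub_distrib, sm_sum, sm_sum]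
      ring
    rw [← sub_zero (∑ a, (softmax ε y a - softmax ε z a) * (y a - z a)), ← h0,
      ← Finset.sum_sub_distrib, Finset.mul_sum]
    refine Finset.sum_congr rfl fun a _ => ?_
    linear_combination (softmax ε y a - softmax ε z a) * (sm_log ε hε y a - sm_log ε hε z a)
  rw [h]
  refine mul_le_mul_of_nonneg_left (Finset.sum_le_sum fun a _ => ?_) hε.le
  exact sm_aux_log' (sm_pos _ _ _) (sm_le_one _ _ _) (sm_pos _ _ _) (sm_le_one _ _ _)

theorem sm_deriv {α : Type*} [Fintype α] [Nonempty α] (ε : ℝ) (hε : 0 < ε) (c : ℝ) (p : α → ℝ)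
    (y : ℝ → α → ℝ) (v : α → ℝ) (t : ℝ) (hy : ∀ a, HasDerivAt (fun s => y s a) (v a) t) :
    HasDerivAt (fun s => ε * Real.log (∑ b, Real.exp (y s b / ε)) + c - ∑ a, p a * y s a)
      (∑ a, (softmax ε (y t) a - p a) * v a) t := by
  have h1 : HasDerivAt (fun s => ∑ b, Real.exp (y s b / ε))
      (∑ b, Real.exp (y t b / ε) * (v b / ε)) t :=
    HasDerivAt.fun_sum fun b _ => ((hy b).div_const ε).exp
  have h2 : HasDerivAt (fun s => ∑ a, p a * y s a) (∑ a, p a * v a) t :=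
    HasDerivAt.fun_sum fun b _ => (hy b).const_mul (p b)
  have h3 := (((h1.log (sm_Zpos ε (y t)).ne').const_mul ε).add_const c).sub h2
  refine h3.congr_deriv ?_
  simp only [sub_mul, Finset.sum_sub_distrib]
  congr 1
  rw [Finset.sum_div, Finset.mul_sum]
  refine Finset.sum_congr rfl fun a _ => ?_
  unfold softmax
  have := (sm_Zpos ε (y t)).ne'
  field_simp

/-- **Lyapunov inequality for the IESL dynamic (core estimate of Theorem 3).**
Along a solution of `ẏ = η (w(σ(y)) − y)`, whenever `σ(y(t))` lies in a policy set on
which the game is locally `μ`-hypomonotone about the rest-point policy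
`π̄_ε = σ(ȳ_ε)`, the energy is differentiable with
`Ė(t) ≤ η (μ − ε) ∑_{i,x,a} (σ(y(t))^i(x,a) − π_ε^i(x,a))²`;
in particular `Ė(t) ≤ 0` if `μ < ε`. -/
theorem iesl_lyapunov_inequality (G : POSG) (hreach : G.ReachPos)
    (ε η : ℝ) (hε : 0 < ε) (hη : 0 < η)
    (yε : G.Score) (hrest : G.w (G.choice ε yε) = yε)
    (Plocal : Set G.JointPolicy) (hPmem : G.choice ε yε ∈ Plocal)
    (μ : ℝ) (hμ0 : 0 ≤ μ)
    (hhypo : ∀ π ∈ Plocal,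
      ∑ i : Fin G.n, ∑ t : Fin G.T, ∑ x : G.LocTraj i t.1, ∑ a : G.A,
          (π i t x a - G.choice ε yε i t x a) *
            (G.w π i t x a - G.w (G.choice ε yε) i t x a) ≤
        μ * ∑ i : Fin G.n, ∑ t : Fin G.T, ∑ x : G.LocTraj i t.1, ∑ a : G.A,
          (π i t x a - G.choice ε yε i t x a) ^ 2)
    (y : ℝ → G.Score)
    (hy : ∀ t : ℝ, HasDerivAt y (η • (G.w (G.choice ε (y t)) - y t)) t) :
    ∀ t : ℝ, G.choice ε (y t) ∈ Plocal →
      ∃ d : ℝ,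
        HasDerivAt (fun s : ℝ => G.energy ε (G.choice ε yε) (y s)) d t ∧
        d ≤ η * (μ - ε) *
          ∑ i : Fin G.n, ∑ t' : Fin G.T, ∑ x : G.LocTraj i t'.1, ∑ a : G.A,
            (G.choice ε (y t) i t' x a - G.choice ε yε i t' x a) ^ 2 ∧
        (μ < ε → d ≤ 0) := by
  intro t ht
  have hH := hhypo _ ht
  have hc : ∀ i t' x a, HasDerivAt (fun s => y s i t' x a)
      (η * (G.w (G.choice ε (y t)) i t' x a - y t i t' x a)) t := by
    intro i t' x a
    have h1 := hasDerivAt_pi.1 (hy t) i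
    have h2 := hasDerivAt_pi.1 h1 t'
    have h3 := hasDerivAt_pi.1 h2 x
    exact hasDerivAt_pi.1 h3 a
  have hS : 0 ≤ ∑ i : Fin G.n, ∑ t' : Fin G.T, ∑ x : G.LocTraj i t'.1, ∑ a : G.A,
            (G.choice ε (y t) i t' x a - G.choice ε yε i t' x a) ^ 2 :=
    Finset.sum_nonneg fun i _ => Finset.sum_nonneg fun t' _ => Finset.sum_nonneg fun x _ =>
      Finset.sum_nonneg fun a _ => sq_nonneg _
  have hM : ε * ∑ i : Fin G.n, ∑ t' : Fin G.T, ∑ x : G.LocTraj i t'.1, ∑ a : G.A,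
            (G.choice ε (y t) i t' x a - G.choice ε yε i t' x a) ^ 2 ≤
      ∑ i : Fin G.n, ∑ t' : Fin G.T, ∑ x : G.LocTraj i t'.1, ∑ a : G.A,
        (G.choice ε (y t) i t' x a - G.choice ε yε i t' x a) * (y t i t' x a - yε i t' x a) := by
    simp only [Finset.mul_sum]
    refine Finset.sum_le_sum fun i _ => Finset.sum_le_sum fun t' _ => Finset.sum_le_sum fun x _ => ?_
    rw [← Finset.mul_sum]
    exact sm_mono ε hε (y t i t' x) (yε i t' x)
  have hD : ∑ i : Fin G.n, ∑ t' : Fin G.T, ∑ x : G.LocTraj i t'.1, ∑ a : G.A,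
        (G.choice ε (y t) i t' x a - G.choice ε yε i t' x a) *
          (η * (G.w (G.choice ε (y t)) i t' x a - y t i t' x a)) =
      η * (∑ i : Fin G.n, ∑ t' : Fin G.T, ∑ x : G.LocTraj i t'.1, ∑ a : G.A,
          (G.choice ε (y t) i t' x a - G.choice ε yε i t' x a) *
            (G.w (G.choice ε (y t)) i t' x a - G.w (G.choice ε yε) i t' x a)
        - ∑ i : Fin G.n, ∑ t' : Fin G.T, ∑ x : G.LocTraj i t'.1, ∑ a : G.A,
        (G.choice ε (y t) i t' x a - G.choice ε yε i t' x a) *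
          (y t i t' x a - yε i t' x a)) := by
    rw [hrest]
    simp only [← Finset.sum_sub_distrib, Finset.mul_sum]
    refine Finset.sum_congr rfl fun i _ => Finset.sum_congr rfl fun t' _ =>
      Finset.sum_congr rfl fun x _ => Finset.sum_congr rfl fun a _ => ?_
    ring
  have hmain : η * (∑ i : Fin G.n, ∑ t' : Fin G.T, ∑ x : G.LocTraj i t'.1, ∑ a : G.A,
          (G.choice ε (y t) i t' x a - G.choice ε yε i t' x a) *
            (G.w (G.choice ε (y t)) i t' x a - G.w (G.choice ε yε) i t' x a)
        - ∑ i : Fin G.n, ∑ t' : Fin G.T, ∑ x : G.LocTraj i t'.1, ∑ a : G.A,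
        (G.choice ε (y t) i t' x a - G.choice ε yε i t' x a) *
          (y t i t' x a - yε i t' x a)) ≤ η * (μ - ε) *
          ∑ i : Fin G.n, ∑ t' : Fin G.T, ∑ x : G.LocTraj i t'.1, ∑ a : G.A,
            (G.choice ε (y t) i t' x a - G.choice ε yε i t' x a) ^ 2 := by
    rw [mul_assoc]
    refine mul_le_mul_of_nonneg_left ?_ hη.le
    rw [sub_mul]
    exact sub_le_sub hH hM
  refine ⟨_, ?_, hD.le.trans hmain, fun hlt => (hD.le.trans hmain).trans ?_⟩
  · unfold POSG.energy
    refine HasDerivAt.fun_sum fun i _ => HasDerivAt.fun_sum fun t' _ =>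
      HasDerivAt.fun_sum fun x _ => ?_
    exact sm_deriv ε hε _ _ (fun s => y s i t' x) _ t (hc i t' x)
  · exact mul_nonpos_of_nonpos_of_nonneg
      (mul_nonpos_of_nonneg_of_nonpos hη.le (by linarith)) hS
end
end
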